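/- Fix integers d ≥ 1 and m ≥ 1 and a real number a. There exists a constant C depending only on d and m such that for every real number r₀ > 2 there exists a C^∞ function f : ℝ → ℝ, supported in the interval [r₀/2, 5r₀/2] ⊂ (1,∞), belonging to the class F_a, and satisfying ∫ |f(r)| r^{d−1} dr ≤ C |a| r₀^{−m}. -/

import Mathlib

/-- The class `F_a`: smooth functions `f : ℝ → ℝ` with compact support contained in `(1, ∞)`,
whose moments `∫ f(r) r^(i+d-1) dr` vanish for `0 ≤ i ≤ m-1` and whose `m`-th moment
`∫ f(r) r^(m+d-1) dr` equals `a`. -/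
def MemFa (d m : ℕ) (a : ℝ) (f : ℝ → ℝ) : Prop :=
  ContDiff ℝ (⊤ : ℕ∞) f ∧ HasCompactSupport f ∧ tsupport f ⊆ Set.Ioi (1 : ℝ) ∧
    (∀ i < m, (∫ r : ℝ, f r * r ^ (i + d - 1)) = 0) ∧
    (∫ r : ℝ, f r * r ^ (m + d - 1)) = a

open MeasureTheory in
/-- Integration by parts against a monomial for a smooth compactly supported function. -/
theorem integral_deriv_mul_pow {F : ℝ → ℝ} (hF : ContDiff ℝ (⊤ : ℕ∞) F)
    (hc : HasCompactSupport F) (k : ℕ) :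
    (∫ r : ℝ, deriv F r * r ^ k) = -(k * ∫ r : ℝ, F r * r ^ (k - 1)) := by
  have hF' : Continuous (deriv F) := hF.continuous_deriv (by simp)
  have h := integral_mul_deriv_eq_deriv_mul_of_integrable (u := fun r : ℝ ↦ r ^ k)
    (u' := fun r ↦ k * r ^ (k - 1)) (v := F) (v' := deriv F)
    (fun x _ ↦ hasDerivAt_pow k x) (fun x _ ↦ (hF.differentiable (by simp) x).hasDerivAt)
    (((continuous_pow k).mul hF').integrable_of_hasCompactSupport hc.deriv.mul_left)
    (((continuous_const.mul (continuous_pow (k - 1))).mul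
      hF.continuous).integrable_of_hasCompactSupport hc.mul_left)
    (((continuous_pow k).mul hF.continuous).integrable_of_hasCompactSupport hc.mul_left)
  rw [← integral_const_mul]
  calc _ = ∫ r : ℝ, r ^ k * deriv F r := by simp only [mul_comm]
    _ = _ := h
    _ = _ := by congr 1; exact integral_congr_ae (.of_forall fun r ↦ by ring)

theorem ContDiff.contDiff_iteratedDeriv_top {g : ℝ → ℝ} (hg : ContDiff ℝ (⊤ : ℕ∞) g) (n : ℕ) :
    ContDiff ℝ (⊤ : ℕ∞) (iteratedDeriv n g) := by
  rw [iteratedDeriv_eq_iterate]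
  exact hg.iterate_deriv n

theorem tsupport_iteratedDeriv_subset (g : ℝ → ℝ) (n : ℕ) :
    tsupport (iteratedDeriv n g) ⊆ tsupport g := by
  induction n with
  | zero => simp
  | succ n ih =>
    rw [iteratedDeriv_succ]
    exact (closure_minimal (support_deriv_subset) (isClosed_tsupport _)).trans ih

theorem HasCompactSupport.hasCompactSupport_iteratedDeriv {g : ℝ → ℝ} (hc : HasCompactSupport g)
    (n : ℕ) : HasCompactSupport (iteratedDeriv n g) :=
  hc.of_isClosed_subset (isClosed_tsupport _) (tsupport_iteratedDeriv_subset g n)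

theorem integral_iteratedDeriv_mul_pow_of_lt {g : ℝ → ℝ} (hg : ContDiff ℝ (⊤ : ℕ∞) g)
    (hc : HasCompactSupport g) {n k : ℕ} (hk : k < n) :
    (∫ r : ℝ, iteratedDeriv n g r * r ^ k) = 0 := by
  induction n generalizing k with
  | zero => omega
  | succ n ih =>
    rw [iteratedDeriv_succ, integral_deriv_mul_pow (hg.contDiff_iteratedDeriv_top n)
      (hc.hasCompactSupport_iteratedDeriv n)]
    cases k with
    | zero => simp
    | succ k => rw [Nat.add_sub_cancel, ih (by omega)]; simp

theorem integral_iteratedDeriv_mul_pow_self {g : ℝ → ℝ} (hg : ContDiff ℝ (⊤ : ℕ∞) g)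
    (hc : HasCompactSupport g) (n : ℕ) :
    (∫ r : ℝ, iteratedDeriv n g r * r ^ n) = (-1) ^ n * n.factorial * ∫ r : ℝ, g r := by
  induction n with
  | zero => simp
  | succ n ih =>
    rw [iteratedDeriv_succ, integral_deriv_mul_pow (hg.contDiff_iteratedDeriv_top n)
      (hc.hasCompactSupport_iteratedDeriv n), Nat.add_sub_cancel, ih, Nat.factorial_succ]
    push_cast
    ring

/-- A smooth profile on `[1/2, 5/2]` with vanishing moments of order `< n` and `n`-th moment `1`. -/
theorem exists_contDiff_moments_eq_zero_moment_eq_one (n : ℕ) :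
    ∃ h : ℝ → ℝ, ContDiff ℝ (⊤ : ℕ∞) h ∧ tsupport h ⊆ Set.Icc (1 / 2) (5 / 2) ∧
      (∀ k < n, (∫ r : ℝ, h r * r ^ k) = 0) ∧ (∫ r : ℝ, h r * r ^ n) = 1 := by
  let φ : ContDiffBump (3 / 2 : ℝ) := ⟨1 / 2, 1, by norm_num, by norm_num⟩
  have hφ : ContDiff ℝ (⊤ : ℕ∞) φ := φ.contDiff
  have hc : HasCompactSupport φ := φ.hasCompactSupport
  have hI := integral_iteratedDeriv_mul_pow_self hφ hc n
  set I := ∫ r : ℝ, iteratedDeriv n φ r * r ^ n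
  have hI0 : I ≠ 0 := by
    rw [hI]
    have := (φ.integral_pos (μ := MeasureTheory.volume)).ne'
    have := n.factorial_ne_zero
    simp_all
  refine ⟨fun r ↦ I⁻¹ * iteratedDeriv n φ r,
    contDiff_const.mul (hφ.contDiff_iteratedDeriv_top n), ?_, fun k hk ↦ ?_, ?_⟩
  · refine (tsupport_mul_subset_right.trans (tsupport_iteratedDeriv_subset _ n)).trans ?_
    rw [φ.tsupport_eq, Real.closedBall_eq_Icc]
    exact Set.Icc_subset_Icc (by norm_num [φ]) (by norm_num [φ])
  · simp only [mul_assoc, MeasureTheory.integral_const_mul,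
      integral_iteratedDeriv_mul_pow_of_lt hφ hc hk, mul_zero]
  · simp only [mul_assoc, MeasureTheory.integral_const_mul]
    exact inv_mul_cancel₀ hI0

theorem integral_comp_div_mul_pow (h : ℝ → ℝ) {s : ℝ} (hs : 0 < s) (k : ℕ) :
    (∫ r : ℝ, h (r / s) * r ^ k) = s ^ (k + 1) * ∫ r : ℝ, h r * r ^ k := by
  have := MeasureTheory.Measure.integral_comp_div (fun r ↦ h r * r ^ k) s
  rw [abs_of_pos hs, smul_eq_mul] at this
  rw [pow_succ, mul_assoc, ← this, ← MeasureTheory.integral_const_mul]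
  congr 1 with r
  rw [div_pow]
  field_simp

/-- For `d ≥ 1` and `m ≥ 1` there is a constant `C = C(d,m) > 0` such that for every `a : ℝ`
and every `r₀ > 2` there is a smooth `f ∈ F_a` supported in `[r₀/2, 5r₀/2]` with
`∫ |f(r)| r^(d-1) dr ≤ C |a| r₀^(-m)`. -/
theorem exists_memFa_supported_with_bound (d m : ℕ) (hd : 1 ≤ d) (hm : 1 ≤ m) :
    ∃ C : ℝ, 0 < C ∧ ∀ (a : ℝ) (r₀ : ℝ), 2 < r₀ →
      ∃ f : ℝ → ℝ, MemFa d m a f ∧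
        tsupport f ⊆ Set.Icc (r₀ / 2) (5 * r₀ / 2) ∧
        (∫ r : ℝ, |f r| * r ^ (d - 1)) ≤ C * |a| * r₀ ^ (-(m : ℤ)) := by
  obtain ⟨h, hh, hsupp, hlt, hself⟩ := exists_contDiff_moments_eq_zero_moment_eq_one (m + d - 1)
  set K := ∫ r : ℝ, |h r| * r ^ (d - 1)
  refine ⟨|K| + 1, by positivity, fun a r₀ hr ↦ ?_⟩
  have h0 : 0 < r₀ := by linarith
  set c := a * (r₀ ^ (m + d))⁻¹
  have hts : tsupport (fun r ↦ c * h (r / r₀)) ⊆ Set.Icc (r₀ / 2) (5 * r₀ / 2) := by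
    refine closure_minimal (fun r hr' ↦ ?_) isClosed_Icc
    have hmem : r / r₀ ∈ Set.Icc (1 / 2 : ℝ) (5 / 2) :=
      hsupp (subset_tsupport h (right_ne_zero_of_mul hr'))
    rw [Set.mem_Icc, le_div_iff₀ h0, div_le_iff₀ h0] at hmem
    constructor <;> linarith [hmem.1, hmem.2]
  have hmom (k : ℕ) : (∫ r : ℝ, c * h (r / r₀) * r ^ k) =
      c * (r₀ ^ (k + 1) * ∫ r : ℝ, h r * r ^ k) := by
    simp only [mul_assoc, MeasureTheory.integral_const_mul, integral_comp_div_mul_pow h h0]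
  refine ⟨fun r ↦ c * h (r / r₀), ⟨contDiff_const.mul (hh.comp (contDiff_id.div_const r₀)),
    isCompact_Icc.of_isClosed_subset (isClosed_tsupport _) hts,
    fun r hr' ↦ lt_of_lt_of_le (by linarith) (hts hr').1, fun i hi ↦ ?_, ?_⟩, hts, ?_⟩
  · rw [hmom, hlt _ (by omega)]
    simp
  · rw [hmom, hself, show m + d - 1 + 1 = m + d by omega]
    simp only [c]
    field_simp
  · have habs : (∫ r : ℝ, |c * h (r / r₀)| * r ^ (d - 1)) = K * |a| * r₀ ^ (-(m : ℤ)) := by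
      simp only [abs_mul, mul_assoc, MeasureTheory.integral_const_mul,
        integral_comp_div_mul_pow (fun r ↦ |h r|) h0]
      rw [show d - 1 + 1 = d by omega, abs_mul, abs_of_pos (a := (r₀ ^ (m + d))⁻¹) (by positivity),
        zpow_neg, zpow_natCast, pow_add]
      simp only [K]
      field_simp
    rw [habs]
    gcongr
    linarith [le_abs_self K]
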